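/- A ring R is left (n,d)-coherent if and only if Ext^2_R(M,N) = 0 for every finitely n-presented R-module M of projective dimension at most d and every FP_n^{≤d}-injective R-module N. -/

import Mathlib

universe u

/-- `M` is a finitely `n`-presented `R`-module. -/
def FinNPres (R : Type u) [Ring R] : ℕ → (M : Type u) → [AddCommGroup M] → [Module R M] → Prop
  | 0, M, _, _ => Module.Finite R M
  | n+1, M, _, _ => ∃ (k : ℕ) (f : (Fin k → R) →ₗ[R] M), Function.Surjective f ∧
      FinNPres R n (LinearMap.ker f)

/-- `M` has projective dimension at most `d` (finite `d`). -/
def ProjDimLE (R : Type u) [Ring R] : ℕ → (M : Type u) → [AddCommGroup M] → [Module R M] → Prop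
  | 0, M, _, _ => Module.Projective R M
  | d+1, M, _, _ => ∃ (ι : Type u) (f : (ι →₀ R) →ₗ[R] M), Function.Surjective f ∧
      ProjDimLE R d (LinearMap.ker f)

/-- Projective dimension at most `d` for `d : ℕ∞`; `d = ⊤` imposes no condition. -/
def ProjDimLE' (R : Type u) [Ring R] (d : ℕ∞) (M : Type u) [AddCommGroup M] [Module R M] : Prop :=
  ∀ k : ℕ, (k : ℕ∞) = d → ProjDimLE R k M

/-- `Ext¹_R(M, N) = 0`, expressed by the splitting of all extensions of `M` by `N`. -/
def Ext1Zero (R : Type u) [Ring R] (M N : Type u) [AddCommGroup M] [Module R M]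
    [AddCommGroup N] [Module R N] : Prop :=
  ∀ (X : Type u) [AddCommGroup X] [Module R X] (i : N →ₗ[R] X) (p : X →ₗ[R] M),
    Function.Injective i → Function.Surjective p → LinearMap.range i = LinearMap.ker p →
    ∃ r : X →ₗ[R] N, r ∘ₗ i = LinearMap.id

/-- `N` is `FPₙ^{≤d}`-injective: `Ext¹_R(K, N) = 0` for every finitely `n`-presented `K`
of projective dimension at most `d`. -/
def FPdInj (R : Type u) [Ring R] (n : ℕ) (d : ℕ∞) (N : Type u)
    [AddCommGroup N] [Module R N] : Prop :=
  ∀ (K : Type u) [AddCommGroup K] [Module R K],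
    FinNPres R n K → ProjDimLE' R d K → Ext1Zero R K N

/-- `M` is `FPₙ^{≤d}`-projective: `Ext¹_R(M, N) = 0` for every `FPₙ^{≤d}`-injective `N`. -/
def FPdProj (R : Type u) [Ring R] (n : ℕ) (d : ℕ∞) (M : Type u)
    [AddCommGroup M] [Module R M] : Prop :=
  ∀ (N : Type u) [AddCommGroup N] [Module R N], FPdInj R n d N → Ext1Zero R M N

/-- `ExtSuccZero R j M N` means `Ext^{j+1}_R(M, N) = 0`, defined by dimension shifting:
`Ext^{j+2}(M,N) = 0` iff `Ext^{j+1}(K,N) = 0` for the kernel `K` of any projective cover. -/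
def ExtSuccZero (R : Type u) [Ring R] : ℕ → (M : Type u) → [AddCommGroup M] → [Module R M] →
    (N : Type u) → [AddCommGroup N] → [Module R N] → Prop
  | 0, M, _, _, N, _, _ => Ext1Zero R M N
  | j+1, M, _, _, N, _, _ => ∀ (P : Type u) [AddCommGroup P] [Module R P],
      Module.Projective R P → ∀ p : P →ₗ[R] M, Function.Surjective p →
        ExtSuccZero R j (LinearMap.ker p) N

/-- `R` is a left `(n,d)`-coherent ring. -/
def NDCohRing (R : Type u) [Ring R] (n : ℕ) (d : ℕ∞) : Prop :=
  ∀ (M : Type u) [AddCommGroup M] [Module R M],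
    FinNPres R n M → ProjDimLE' R d M → FinNPres R (n + 1) M


section FinNPresLemmas

variable {R : Type u} [Ring R]

theorem FinNPres.equiv {n : ℕ} {M M' : Type u} [AddCommGroup M] [Module R M]
    [AddCommGroup M'] [Module R M'] (e : M ≃ₗ[R] M') (h : FinNPres R n M) : FinNPres R n M' := by
  cases n with
  | zero =>
    have : Module.Finite R M := h
    exact Module.Finite.equiv e
  | succ n =>
    obtain ⟨k, f, hf, hk⟩ := h
    refine ⟨k, e.toLinearMap ∘ₗ f, e.surjective.comp hf, ?_⟩
    rw [LinearEquiv.ker_comp]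
    exact hk

theorem FinNPres.of_equiv_fin {n k : ℕ} {F M : Type u} [AddCommGroup M] [Module R M]
    [AddCommGroup F] [Module R F] (e : (Fin k → R) ≃ₗ[R] F) (f : F →ₗ[R] M)
    (hf : Function.Surjective f) (h : FinNPres R n (LinearMap.ker f)) : FinNPres R (n + 1) M := by
  refine ⟨k, f ∘ₗ e.toLinearMap, hf.comp e.surjective, ?_⟩
  refine FinNPres.equiv (LinearEquiv.symm ?_) h
  refine LinearEquiv.ofSubmodules e _ _ ?_
  ext x
  simp only [Submodule.mem_map, LinearMap.mem_ker]
  constructor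
  · rintro ⟨y, hy, rfl⟩; exact hy
  · intro hx; exact ⟨e.symm x, by simpa using hx, by simp⟩

theorem FinNPres.finite {n : ℕ} {M : Type u} [AddCommGroup M] [Module R M]
    (h : FinNPres R n M) : Module.Finite R M := by
  cases n with
  | zero => exact h
  | succ n =>
    obtain ⟨k, f, hf, -⟩ := h
    exact Module.Finite.of_surjective f hf

theorem FinNPres.pred {n : ℕ} {M : Type u} [AddCommGroup M] [Module R M]
    (h : FinNPres R (n + 1) M) : FinNPres R n M := by
  induction n generalizing M with
  | zero => exact h.finite
  | succ n ih =>
    obtain ⟨k, f, hf, hk⟩ := h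
    exact ⟨k, f, hf, ih hk⟩

theorem FinNPres.of_subsingleton (n : ℕ) (M : Type u) [AddCommGroup M] [Module R M]
    [Subsingleton M] : FinNPres R n M := by
  induction n generalizing M with
  | zero => exact (inferInstance : Module.Finite R M)
  | succ n ih => exact ⟨0, 0, fun x => ⟨0, Subsingleton.elim _ _⟩, ih _⟩

theorem FinNPres.free (n k : ℕ) : FinNPres R n (Fin k → R) := by
  cases n with
  | zero => exact (inferInstance : Module.Finite R (Fin k → R))
  | succ n =>
    refine ⟨k, LinearMap.id, Function.surjective_id, ?_⟩
    rw [LinearMap.ker_id]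
    exact FinNPres.of_subsingleton _ _

theorem FinNPres.ext {n : ℕ} {A B C : Type u} [AddCommGroup A] [Module R A]
    [AddCommGroup B] [Module R B] [AddCommGroup C] [Module R C]
    (i : A →ₗ[R] B) (p : B →ₗ[R] C) (hi : Function.Injective i) (hp : Function.Surjective p)
    (hip : LinearMap.range i = LinearMap.ker p)
    (hA : FinNPres R n A) (hC : FinNPres R n C) : FinNPres R n B := by
  induction n generalizing A B C with
  | zero =>
    have : Module.Finite R A := hA
    have : Module.Finite R C := hC
    have h1 : (LinearMap.ker p).FG := by
      rw [← hip, LinearMap.range_eq_map]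
      exact (Module.Finite.fg_top).map i
    have : Module.Finite R B := by
      refine ⟨Submodule.fg_of_fg_map_of_fg_inf_ker p ?_ ?_⟩
      · rw [← LinearMap.range_eq_map, LinearMap.range_eq_top.2 hp]
        exact Module.Finite.fg_top
      · simpa using h1
    exact this
  | succ n ih =>
    obtain ⟨a, f, hf, hkf⟩ := hA
    obtain ⟨c, g, hg, hkg⟩ := hC
    obtain ⟨g', hg'⟩ := Module.projective_lifting_property p g hp
    have hg'' : ∀ y, p (g' y) = g y := fun y => LinearMap.congr_fun hg' y
    have hpi : ∀ x, p (i x) = 0 := fun x => by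
      have : i x ∈ LinearMap.ker p := hip ▸ LinearMap.mem_range_self i x
      exact this
    have hex : ∀ b, p b = 0 → ∃ x, i x = b := fun b hb => by
      have : b ∈ LinearMap.range i := hip ▸ hb
      exact this
    let h : ((Fin a → R) × (Fin c → R)) →ₗ[R] B := LinearMap.coprod (i ∘ₗ f) g'
    have hsurj : Function.Surjective h := by
      intro b
      obtain ⟨y, hy⟩ := hg (p b)
      obtain ⟨x, hx⟩ := hex (b - g' y) (by rw [map_sub, hg'', hy, sub_self])
      obtain ⟨z, rfl⟩ := hf x
      exact ⟨(z, y), by simp [h, hx]⟩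
    let e : (Fin (a + c) → R) ≃ₗ[R] ((Fin a → R) × (Fin c → R)) :=
      (LinearEquiv.funCongrLeft R R finSumFinEquiv).trans
        (LinearEquiv.sumArrowLequivProdArrow (Fin a) (Fin c) R R)
    refine FinNPres.of_equiv_fin e h hsurj ?_
    let i' : LinearMap.ker f →ₗ[R] LinearMap.ker h :=
      LinearMap.restrict (LinearMap.inl R (Fin a → R) (Fin c → R)) (by
        intro x hx
        have : f x = 0 := hx
        simp [h, this])
    let p' : LinearMap.ker h →ₗ[R] LinearMap.ker g :=
      LinearMap.restrict (LinearMap.snd R (Fin a → R) (Fin c → R)) (by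
        rintro ⟨x, y⟩ hx
        have h0 : i (f x) + g' y = 0 := by simpa [h] using hx
        have h1 := congrArg p h0
        simpa [hpi, hg''] using h1)
    refine ih i' p' ?_ ?_ ?_ hkf hkg
    · intro x y hxy
      have := congrArg (fun z => z.1.1) hxy
      exact Subtype.ext this
    · rintro ⟨y, hy⟩
      have hy' : g y = 0 := hy
      obtain ⟨x, hx⟩ := hex (g' y) (by rw [hg'', hy'])
      obtain ⟨z, rfl⟩ := hf x
      refine ⟨⟨(-z, y), ?_⟩, ?_⟩
      · simp [h, hx]
      · exact Subtype.ext rfl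
    · ext ⟨⟨x, y⟩, hxy⟩
      have h0 : i (f x) + g' y = 0 := by simpa [h] using hxy
      constructor
      · rintro ⟨z, hz⟩
        have h2 := congrArg (fun z => z.1.2) hz
        have h2' : 0 = y := h2
        exact Subtype.ext h2'.symm
      · intro hz
        have hz' : y = 0 := congrArg Subtype.val hz
        subst hz'
        have h3 : f x = 0 := hi (by simpa using h0)
        exact ⟨⟨x, h3⟩, Subtype.ext rfl⟩

theorem FinNPres.fst {n : ℕ} {A B : Type u} [AddCommGroup A] [Module R A]
    [AddCommGroup B] [Module R B] (h : FinNPres R n (A × B)) : FinNPres R n A := by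
  induction n generalizing A B with
  | zero =>
    have : Module.Finite R (A × B) := h
    have : Module.Finite R A :=
      Module.Finite.of_surjective (LinearMap.fst R A B) LinearMap.fst_surjective
    exact this
  | succ n ih =>
    have hB : FinNPres R n B := ih (FinNPres.equiv (LinearEquiv.prodComm R A B) h.pred)
    obtain ⟨k, f, hf, hk⟩ := h
    refine ⟨k, LinearMap.fst R A B ∘ₗ f, Prod.fst_surjective.comp hf, ?_⟩
    let i : LinearMap.ker f →ₗ[R] LinearMap.ker (LinearMap.fst R A B ∘ₗ f) :=
      Submodule.inclusion (by
        intro x hx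
        have : f x = 0 := hx
        simp [this])
    let p : LinearMap.ker (LinearMap.fst R A B ∘ₗ f) →ₗ[R] B :=
      LinearMap.snd R A B ∘ₗ f ∘ₗ Submodule.subtype _
    refine FinNPres.ext i p (Submodule.inclusion_injective _) ?_ ?_ hk hB
    · intro b
      obtain ⟨x, hx⟩ := hf (0, b)
      exact ⟨⟨x, by simp [hx]⟩, by simp [p, hx]⟩
    · ext ⟨x, hx⟩
      have hx' : (f x).1 = 0 := by simpa using hx
      constructor
      · rintro ⟨⟨z, hz⟩, hzx⟩
        have h2 : z = x := congrArg Subtype.val hzx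
        subst h2
        have hz' : f z = 0 := hz
        simp [p, hz']
      · intro h
        have h2 : (f x).2 = 0 := by simpa [p] using h
        exact ⟨⟨x, Prod.ext hx' h2⟩, Subtype.ext rfl⟩

theorem FinNPres.finitePresentation {n : ℕ} (hn : 1 ≤ n) {M : Type u} [AddCommGroup M]
    [Module R M] (h : FinNPres R n M) : Module.FinitePresentation R M := by
  obtain ⟨n, rfl⟩ : ∃ m, n = m + 1 := ⟨n - 1, by omega⟩
  obtain ⟨k, f, hf, hk⟩ := h
  have : Module.Finite R (LinearMap.ker f) := hk.finite
  exact Module.finitePresentation_of_surjective f hf (Module.Finite.iff_fg.1 this)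

/-- Ranges of linear maps with the same kernel are isomorphic. -/
theorem FinNPres.range_of_ker_eq {n : ℕ} {Z P Q : Type u} [AddCommGroup Z] [Module R Z]
    [AddCommGroup P] [Module R P] [AddCommGroup Q] [Module R Q]
    (a : Z →ₗ[R] P) (b : Z →ₗ[R] Q) (hab : LinearMap.ker a = LinearMap.ker b)
    (h : FinNPres R n (LinearMap.range a)) : FinNPres R n (LinearMap.range b) :=
  h.equiv ((a.quotKerEquivRange.symm.trans (Submodule.quotEquivOfEq _ _ hab)).trans
    b.quotKerEquivRange)

end FinNPresLemmas

section ExtLemmas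

variable {R : Type u} [Ring R]

/-- Pushouts of a submodule inclusion. -/
theorem exists_pushout {F N : Type u} [AddCommGroup F] [Module R F] [AddCommGroup N] [Module R N]
    (T : Submodule R F) (φ : T →ₗ[R] N) :
    ∃ (N' : Type u) (_ : AddCommGroup N') (_ : Module R N') (j : N →ₗ[R] N') (g : F →ₗ[R] N')
      (q : N' →ₗ[R] (F ⧸ T)), Function.Injective j ∧ Function.Surjective q ∧
        LinearMap.range j = LinearMap.ker q ∧ (∀ y, q (g y) = T.mkQ y) ∧
        (∀ t : T, g t = j (φ t)) := by
  let w : T →ₗ[R] (N × F) := LinearMap.prod (-φ) T.subtype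
  let W := LinearMap.range w
  have hW : W ≤ LinearMap.ker (T.mkQ ∘ₗ LinearMap.snd R N F) := by
    rintro _ ⟨t, rfl⟩
    simp [w]
  refine ⟨(N × F) ⧸ W, inferInstance, inferInstance, W.mkQ ∘ₗ LinearMap.inl R N F,
    W.mkQ ∘ₗ LinearMap.inr R N F, W.liftQ (T.mkQ ∘ₗ LinearMap.snd R N F) hW, ?_, ?_, ?_, ?_, ?_⟩
  · rw [← LinearMap.ker_eq_bot, LinearMap.ker_eq_bot']
    intro m hm
    have h1 : ((m, 0) : N × F) ∈ W := by simpa using hm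
    obtain ⟨t, ht⟩ := h1
    have h2 : (t : F) = 0 := congrArg Prod.snd ht
    have h3 : -φ t = m := congrArg Prod.fst ht
    have h4 : t = 0 := Subtype.ext h2
    rw [← h3, h4]; simp
  · intro y
    obtain ⟨x, rfl⟩ := T.mkQ_surjective y
    exact ⟨W.mkQ (0, x), by simp⟩
  · ext x
    obtain ⟨⟨m, y⟩, rfl⟩ := W.mkQ_surjective x
    constructor
    · rintro ⟨z, hz⟩
      rw [← hz]; simp
    · intro h
      have hy : y ∈ T := by simpa using h
      refine ⟨m + φ ⟨y, hy⟩, ?_⟩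
      have h1 : ((m + φ ⟨y, hy⟩, 0) : N × F) - (m, y) ∈ W := ⟨-⟨y, hy⟩, by simp [w]⟩
      simpa using (Submodule.Quotient.eq W).2 h1
  · intro y; simp
  · intro t
    have h1 : ((0, (t : F)) : N × F) - (φ t, 0) ∈ W := ⟨t, by simp [w]⟩
    simpa using (Submodule.Quotient.eq W).2 h1

/-- A map defined on the source of a surjection that kills the kernel descends. -/
theorem exists_descend {P K X : Type u} [AddCommGroup P] [Module R P] [AddCommGroup K] [Module R K]
    [AddCommGroup X] [Module R X] (π : P →ₗ[R] K) (hπ : Function.Surjective π) (h : P →ₗ[R] X)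
    (hh : ∀ y, π y = 0 → h y = 0) : ∃ s : K →ₗ[R] X, ∀ y, s (π y) = h y := by
  refine ⟨(LinearMap.ker π).liftQ h hh ∘ₗ (π.quotKerEquivOfSurjective hπ).symm.toLinearMap, ?_⟩
  intro y
  have : (π.quotKerEquivOfSurjective hπ).symm (π y) = (LinearMap.ker π).mkQ y := by
    rw [LinearEquiv.symm_apply_eq]; rfl
  rw [LinearMap.comp_apply, LinearEquiv.coe_coe, this]
  rfl

/-- An injection can be inverted on maps landing in its range. -/
theorem exists_corestrict {P N X : Type u} [AddCommGroup P] [Module R P] [AddCommGroup N]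
    [Module R N] [AddCommGroup X] [Module R X] (i : N →ₗ[R] X) (hi : Function.Injective i)
    (h : P →ₗ[R] X) (hh : ∀ y, h y ∈ LinearMap.range i) :
    ∃ s : P →ₗ[R] N, ∀ y, i (s y) = h y := by
  refine ⟨(LinearEquiv.ofInjective i hi).symm.toLinearMap ∘ₗ h.codRestrict _ hh, ?_⟩
  intro y
  have := (LinearEquiv.ofInjective i hi).apply_symm_apply (h.codRestrict _ hh y)
  exact congrArg Subtype.val this

/-- A section of an extension gives a retraction. -/
theorem retraction_of_section {M N X : Type u} [AddCommGroup M] [Module R M] [AddCommGroup N]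
    [Module R N] [AddCommGroup X] [Module R X] (i : N →ₗ[R] X) (p : X →ₗ[R] M)
    (hi : Function.Injective i) (hip : LinearMap.range i = LinearMap.ker p)
    (s : M →ₗ[R] X) (hs : ∀ m, p (s m) = m) : ∃ r : X →ₗ[R] N, r ∘ₗ i = LinearMap.id := by
  obtain ⟨r, hr⟩ := exists_corestrict i hi (LinearMap.id - s ∘ₗ p) (by
    intro y; rw [hip]; simp [hs])
  refine ⟨r, ?_⟩
  ext x
  apply hi
  have : p (i x) = 0 := by
    have : i x ∈ LinearMap.ker p := hip ▸ LinearMap.mem_range_self i x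
    exact this
  simp [hr, this]

/-- If `Ext¹(K,N) = 0`, then maps to `N` extend from the kernel of a surjection onto `K`. -/
theorem Ext1Zero.extend {P K N : Type u} [AddCommGroup P] [Module R P] [AddCommGroup K]
    [Module R K] [AddCommGroup N] [Module R N] (h : Ext1Zero R K N)
    (π : P →ₗ[R] K) (hπ : Function.Surjective π) (φ : LinearMap.ker π →ₗ[R] N) :
    ∃ g : P →ₗ[R] N, ∀ t : LinearMap.ker π, g t = φ t := by
  obtain ⟨X, _, _, j, g, q, hj, hq, hjq, -, hg⟩ := exists_pushout (LinearMap.ker π) φ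
  obtain ⟨r, hr⟩ := h X j ((π.quotKerEquivOfSurjective hπ).toLinearMap ∘ₗ q) hj
    ((π.quotKerEquivOfSurjective hπ).surjective.comp hq) (by rw [LinearEquiv.ker_comp, hjq])
  exact ⟨r ∘ₗ g, fun t => by
    have := LinearMap.congr_fun hr (φ t)
    simpa [hg] using this⟩

/-- Converse for projective sources. -/
theorem Ext1Zero.of_extend {P K N : Type u} [AddCommGroup P] [Module R P] [Module.Projective R P]
    [AddCommGroup K] [Module R K] [AddCommGroup N] [Module R N]
    (π : P →ₗ[R] K) (hπ : Function.Surjective π)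
    (h : ∀ φ : LinearMap.ker π →ₗ[R] N, ∃ g : P →ₗ[R] N, ∀ t : LinearMap.ker π, g t = φ t) :
    Ext1Zero R K N := by
  intro X _ _ i p hi hp hip
  obtain ⟨l, hl⟩ := Module.projective_lifting_property p π hp
  have hl' : ∀ y, p (l y) = π y := fun y => LinearMap.congr_fun hl y
  obtain ⟨φ, hφ⟩ := exists_corestrict i hi (l ∘ₗ (LinearMap.ker π).subtype) (by
    rintro ⟨y, hy⟩
    rw [hip, LinearMap.mem_ker]
    have : π y = 0 := hy
    simp [hl', this])
  obtain ⟨g, hg⟩ := h φ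
  obtain ⟨s, hs⟩ := exists_descend π hπ (l - i ∘ₗ g) (by
    intro y hy
    have h1 := hφ ⟨y, hy⟩
    have h2 := hg ⟨y, hy⟩
    simp only [LinearMap.comp_apply, Submodule.subtype_apply] at h1 h2
    simp [h2, h1])
  refine retraction_of_section i p hi hip s ?_
  intro m
  obtain ⟨y, rfl⟩ := hπ m
  have : p (i (g y)) = 0 := by
    have : i (g y) ∈ LinearMap.ker p := hip ▸ LinearMap.mem_range_self i _
    exact this
  simp [hs, hl', this]

/-- If `Ext¹(A,N) = 0` maps out of `A` lift along surjections with kernel `N`. -/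
theorem Ext1Zero.lift {A M N X : Type u} [AddCommGroup A] [Module R A] [AddCommGroup M] [Module R M]
    [AddCommGroup N] [Module R N] [AddCommGroup X] [Module R X] (h : Ext1Zero R A N)
    (i : N →ₗ[R] X) (p : X →ₗ[R] M)
    (hi : Function.Injective i) (hp : Function.Surjective p)
    (hip : LinearMap.range i = LinearMap.ker p) (b : A →ₗ[R] M) :
    ∃ σ : A →ₗ[R] X, ∀ a, p (σ a) = b a := by
  have hpi : ∀ x, p (i x) = 0 := fun x => by
    have : i x ∈ LinearMap.ker p := hip ▸ LinearMap.mem_range_self i x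
    exact this
  have hex : ∀ b, p b = 0 → ∃ x, i x = b := fun b hb => by
    have : b ∈ LinearMap.range i := hip ▸ hb
    exact this
  let Q : Submodule R (X × A) := LinearMap.ker (p.coprod (-b))
  have hQ : ∀ z : X × A, z ∈ Q ↔ p z.1 = b z.2 := by
    intro z
    simp [Q, ← sub_eq_add_neg, sub_eq_zero]
  let i' : N →ₗ[R] Q := (LinearMap.inl R X A ∘ₗ i).codRestrict Q (fun x => by simp [hQ, hpi])
  let p' : Q →ₗ[R] A := LinearMap.snd R X A ∘ₗ Q.subtype
  obtain ⟨r, hr⟩ := h Q i' p' (by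
      intro x y hxy
      have : i x = i y := congrArg (fun z => z.1.1) hxy
      exact hi this) (by
      intro a
      obtain ⟨x, hx⟩ := hp (b a)
      exact ⟨⟨(x, a), (hQ _).2 hx⟩, rfl⟩) (by
      ext ⟨⟨x, a⟩, hz⟩
      have hz' := (hQ _).1 hz
      constructor
      · rintro ⟨y, hy⟩
        have : (0 : A) = a := congrArg (fun z => z.1.2) hy
        exact this.symm
      · intro ha
        have ha' : a = 0 := ha
        subst ha'
        obtain ⟨y, hy⟩ := hex x (by simpa using hz')
        exact ⟨y, Subtype.ext (Prod.ext hy rfl)⟩)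
  have hr' : ∀ y, r (i' y) = y := fun y => LinearMap.congr_fun hr y
  obtain ⟨σ, hσ⟩ := exists_descend p' (by
      intro a
      obtain ⟨x, hx⟩ := hp (b a)
      exact ⟨⟨(x, a), (hQ _).2 hx⟩, rfl⟩)
    (LinearMap.fst R X A ∘ₗ Q.subtype - i ∘ₗ r) (by
      rintro ⟨⟨x, a⟩, hz⟩ ha
      have hz' := (hQ _).1 hz
      have ha' : a = 0 := ha
      subst ha'
      obtain ⟨y, hy⟩ := hex x (by simpa using hz')
      have h1 : (⟨(x, 0), hz⟩ : Q) = i' y := Subtype.ext (Prod.ext hy.symm rfl)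
      rw [h1]
      have h2 : ((i' y : Q) : X × A).1 = i y := rfl
      simp [hr', h2])
  refine ⟨σ, fun a => ?_⟩
  obtain ⟨x, hx⟩ := hp (b a)
  have h2 := hσ ⟨(x, a), (hQ _).2 hx⟩
  have h3 : σ a = x - i (r ⟨(x, a), (hQ _).2 hx⟩) := h2
  rw [h3]
  simp [hpi, hx]

/-- Dimension shifting does not depend on the chosen projective presentation. -/
theorem Ext1Zero.schanuel {P F M N : Type u} [AddCommGroup P] [Module R P] [Module.Projective R P]
    [AddCommGroup F] [Module R F] [Module.Projective R F] [AddCommGroup M] [Module R M]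
    [AddCommGroup N] [Module R N] (f : F →ₗ[R] M) (hf : Function.Surjective f)
    (p : P →ₗ[R] M) (hp : Function.Surjective p) (h : Ext1Zero R (LinearMap.ker f) N) :
    Ext1Zero R (LinearMap.ker p) N := by
  obtain ⟨α, hα⟩ := Module.projective_lifting_property f p hf
  obtain ⟨β, hβ⟩ := Module.projective_lifting_property p f hp
  have hα' : ∀ y, f (α y) = p y := fun y => LinearMap.congr_fun hα y
  have hβ' : ∀ y, p (β y) = f y := fun y => LinearMap.congr_fun hβ y
  intro X _ _ i q hi hq hiq
  obtain ⟨σ, hσ⟩ := h.lift i q hi hq hiq (β.restrict (p := LinearMap.ker f) (q := LinearMap.ker p)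
    (by intro x hx; have : f x = 0 := hx; simp [hβ', this]))
  obtain ⟨τ, hτ⟩ := Module.projective_lifting_property q
    ((LinearMap.id - β ∘ₗ α).codRestrict (LinearMap.ker p) (by intro x; simp [hβ', hα'])) hq
  have hτ' := fun y => LinearMap.congr_fun hτ y
  refine retraction_of_section i q hi hiq
    (σ ∘ₗ α.restrict (p := LinearMap.ker p) (q := LinearMap.ker f)
      (by intro x hx; have : p x = 0 := hx; simp [hα', this])
      + τ ∘ₗ (LinearMap.ker p).subtype) ?_
  intro m
  have h1 := hτ' m
  simp only [LinearMap.comp_apply] at h1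
  simp only [LinearMap.add_apply, LinearMap.comp_apply, map_add, hσ, Submodule.subtype_apply, h1]
  apply Subtype.ext
  simp

end ExtLemmas

section PdLemmas

variable {R : Type u} [Ring R]

open CategoryTheory in
theorem projDimLE_iff (d : ℕ) (M : Type u) [AddCommGroup M] [Module R M] :
    ProjDimLE R d M ↔ HasProjectiveDimensionLE (ModuleCat.of R M) d := by
  induction d generalizing M with
  | zero =>
    rw [← projective_iff_hasProjectiveDimensionLE_zero, ← IsProjective.iff_projective]
    rfl
  | succ d ih =>
    have key : ∀ (ι : Type u) (f : (ι →₀ R) →ₗ[R] M), Function.Surjective f →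
        (HasProjectiveDimensionLE (ModuleCat.of R M) (d + 1) ↔
          ProjDimLE R d (LinearMap.ker f)) := by
      intro ι f hf
      rw [ih]
      have hS := LinearMap.shortExact_shortComplexKer hf
      have hP : Projective (ModuleCat.of R (ι →₀ R)) :=
        (IsProjective.iff_projective (R := R) (ι →₀ R)).1 inferInstance
      exact hS.hasProjectiveDimensionLT_X₃_iff d hP
    constructor
    · rintro ⟨ι, f, hf, hk⟩
      exact (key ι f hf).2 hk
    · intro h
      have hs : Function.Surjective (Finsupp.linearCombination R (id : M → M)) :=
        Finsupp.linearCombination_id_surjective R M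
      exact ⟨M, _, hs, (key M _ hs).1 h⟩

open CategoryTheory in
theorem ProjDimLE'.ker {d : ℕ∞} (hd : 1 ≤ d) {M F : Type u} [AddCommGroup M] [Module R M]
    [AddCommGroup F] [Module R F] [Module.Projective R F] (f : F →ₗ[R] M)
    (hf : Function.Surjective f) (h : ProjDimLE' R d M) : ProjDimLE' R d (LinearMap.ker f) := by
  intro k hk
  have h1 := h k hk
  rw [projDimLE_iff] at h1 ⊢
  subst hk
  obtain ⟨m, rfl⟩ : ∃ m, k = m + 1 := by
    have : 1 ≤ k := by exact_mod_cast hd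
    exact ⟨k - 1, by omega⟩
  have hS := LinearMap.shortExact_shortComplexKer hf
  have hP : Projective (ModuleCat.of R F) :=
    (IsProjective.iff_projective (R := R) F).1 inferInstance
  have h2 : HasProjectiveDimensionLT (ModuleCat.of R (LinearMap.ker f)) (m + 1) :=
    (hS.hasProjectiveDimensionLT_X₃_iff m hP).1 h1
  exact hasProjectiveDimensionLT_of_ge _ (m + 1) _ (by omega)

open CategoryTheory Limits in
theorem exists_seq_colimit (G : ℕ → ModuleCat.{u} R) (f : ∀ i, G i →ₗ[R] G (i + 1))
    (hf : ∀ i, Function.Injective (f i)) :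
    ∃ (N : Type u) (_ : AddCommGroup N) (_ : Module R N) (c : ∀ i, G i →ₗ[R] N),
      (∀ i, Function.Injective (c i)) ∧ (∀ i x, c (i + 1) (f i x) = c i x) ∧
      (∀ x, ∃ i y, c i y = x) := by
  let F : ℕ ⥤ ModuleCat.{u} R := Functor.ofSequence (X := G) (fun i => ModuleCat.ofHom (f i))
  have hinj : ∀ i k : ℕ, ∀ h : i ⟶ i + k, Function.Injective (F.map h) := by
    intro i k
    induction k with
    | zero =>
      intro h
      have : h = 𝟙 i := Subsingleton.elim _ _
      rw [this, F.map_id]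
      exact Function.injective_id
    | succ k ih =>
      intro h
      have e : h = homOfLE (Nat.le_add_right i k) ≫ homOfLE (Nat.le_add_right (i + k) 1) :=
        Subsingleton.elim _ _
      rw [e, F.map_comp]
      have e2 : F.map (homOfLE (Nat.le_add_right (i + k) 1)) = ModuleCat.ofHom (f (i + k)) :=
        Functor.ofSequence_map_homOfLE_succ _ _
      rw [e2]
      exact (hf (i + k)).comp (ih _)
  have : PreservesFilteredColimitsOfSize.{0, 0} (forget (ModuleCat.{u} R)) :=
    preservesFilteredColimitsOfSize_shrink.{0, u, 0, u} _
  refine ⟨(colimit F : ModuleCat.{u} R), inferInstance, inferInstance,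
    fun i => (colimit.ι F i).hom, ?_, ?_, ?_⟩
  · intro i x y hxy
    obtain ⟨k, a, b, hk⟩ := Concrete.isColimit_exists_of_rep_eq F (colimit.isColimit F) x y hxy
    have hab : a = b := Subsingleton.elim _ _
    subst hab
    obtain ⟨l, rfl⟩ := Nat.exists_eq_add_of_le (leOfHom a)
    exact hinj i l a hk
  · intro i x
    have e2 : F.map (homOfLE (Nat.le_add_right i 1)) = ModuleCat.ofHom (f i) :=
        Functor.ofSequence_map_homOfLE_succ _ _
    have h1 := colimit.w F (homOfLE (Nat.le_add_right i 1))
    rw [e2] at h1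
    exact congrArg (fun g => g.hom x) h1
  · intro x
    exact Concrete.colimit_exists_rep F x

end PdLemmas

section GoodEmbeddings

variable {R : Type u} [Ring R]

/-- The image of `B` in `M ⧸ A` is finitely `n`-presented. -/
def NPQ (n : ℕ) {M : Type u} [AddCommGroup M] [Module R M] (A B : Submodule R M) : Prop :=
  FinNPres R n (B.map A.mkQ)

theorem NPQ.trans {n : ℕ} {M : Type u} [AddCommGroup M] [Module R M] {A B D : Submodule R M}
    (hAB : A ≤ B) (hBD : B ≤ D) (h1 : NPQ n A B) (h2 : NPQ n B D) : NPQ n A D := by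
  let t : (M ⧸ A) →ₗ[R] (M ⧸ B) := Submodule.factor hAB
  have ht : ∀ x, t (A.mkQ x) = B.mkQ x := fun x => rfl
  let i : B.map A.mkQ →ₗ[R] D.map A.mkQ := Submodule.inclusion (Submodule.map_mono hBD)
  let p : D.map A.mkQ →ₗ[R] D.map B.mkQ := t.restrict (by
    rintro _ ⟨x, hx, rfl⟩
    exact ⟨x, hx, (ht x).symm⟩)
  refine FinNPres.ext i p (Submodule.inclusion_injective _) ?_ ?_ h1 h2
  · rintro ⟨_, x, hx, rfl⟩
    exact ⟨⟨A.mkQ x, x, hx, rfl⟩, Subtype.ext (ht x)⟩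
  · ext ⟨_, x, hx, rfl⟩
    constructor
    · rintro ⟨⟨_, y, hy, rfl⟩, hz⟩
      have h3 : A.mkQ y = A.mkQ x := congrArg Subtype.val hz
      refine Subtype.ext ?_
      change t (A.mkQ x) = 0
      rw [← h3, ht]
      simpa using hy
    · intro hz
      have h3 : t (A.mkQ x) = 0 := congrArg Subtype.val hz
      rw [ht] at h3
      have h4 : x ∈ B := by simpa using h3
      exact ⟨⟨A.mkQ x, x, h4, rfl⟩, Subtype.ext rfl⟩

theorem NPQ.of_range {n : ℕ} {M Z Q : Type u} [AddCommGroup M] [Module R M]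
    [AddCommGroup Z] [Module R Z] [AddCommGroup Q] [Module R Q]
    {A B : Submodule R M} (v : Z →ₗ[R] M) (w : Z →ₗ[R] Q) (hB : B = A ⊔ LinearMap.range v)
    (hw : ∀ z, w z = 0 ↔ v z ∈ A) (h : FinNPres R n (LinearMap.range w)) : NPQ n A B := by
  have h1 : B.map A.mkQ = LinearMap.range (A.mkQ ∘ₗ v) := by
    rw [hB, Submodule.map_sup, LinearMap.range_comp]
    simp
  unfold NPQ
  rw [h1]
  refine FinNPres.range_of_ker_eq w _ ?_ h
  ext z
  simp [hw]

theorem NPQ.map {n : ℕ} {M M' : Type u} [AddCommGroup M] [Module R M]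
    [AddCommGroup M'] [Module R M'] {A B : Submodule R M} (hAB : A ≤ B) (j : M →ₗ[R] M')
    (hj : Function.Injective j) (h : NPQ n A B) : NPQ n (A.map j) (B.map j) := by
  refine NPQ.of_range (j ∘ₗ B.subtype) (A.mkQ ∘ₗ B.subtype) ?_ ?_ ?_
  · rw [LinearMap.range_comp, Submodule.range_subtype, eq_comm, sup_eq_right]
    exact Submodule.map_mono hAB
  · intro z
    simp [hj.eq_iff]
  · rw [LinearMap.range_comp, Submodule.range_subtype]
    exact h

/-- Every finitely generated submodule of `N` is contained in some `B` containing the image of `L`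
with `B / L` finitely `n`-presented. -/
def GoodEmb (n : ℕ) {L N : Type u} [AddCommGroup L] [Module R L] [AddCommGroup N] [Module R N]
    (j : L →ₗ[R] N) : Prop :=
  ∀ X : Submodule R N, X.FG → ∃ B : Submodule R N, X ≤ B ∧ LinearMap.range j ≤ B ∧
    NPQ n (LinearMap.range j) B

theorem GoodEmb.id (n : ℕ) (L : Type u) [AddCommGroup L] [Module R L] :
    GoodEmb n (LinearMap.id : L →ₗ[R] L) := by
  intro X _
  refine ⟨⊤, le_top, le_top, ?_⟩
  unfold NPQ
  rw [LinearMap.range_id]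
  have : Subsingleton (L ⧸ (⊤ : Submodule R L)) := 
    Submodule.Quotient.subsingleton_iff.2 rfl
  exact FinNPres.of_subsingleton _ _

theorem exists_fg_lift {M Q : Type u} [AddCommGroup M] [Module R M]
    [AddCommGroup Q] [Module R Q] (q : M →ₗ[R] Q) (D : Submodule R M) (h : (D.map q).FG) :
    ∃ Y : Submodule R M, Y.FG ∧ Y ≤ D ∧ Y.map q = D.map q := by
  classical
  obtain ⟨s, hs⟩ := h
  have h1 : (s : Set Q) ⊆ q '' (D : Set M) := by
    intro x hx
    have : x ∈ D.map q := hs ▸ Submodule.subset_span hx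
    exact this
  obtain ⟨t, ht, hts⟩ := Finset.subset_set_image_iff.1 h1
  refine ⟨Submodule.span R t, ⟨t, rfl⟩, Submodule.span_le.2 ht, ?_⟩
  rw [Submodule.map_span, ← hs, ← hts, Finset.coe_image]

theorem GoodEmb.comp {n : ℕ} (hn : 1 ≤ n) {L N N' : Type u} [AddCommGroup L] [Module R L]
    [AddCommGroup N] [Module R N] [AddCommGroup N'] [Module R N']
    {j : L →ₗ[R] N} {j' : N →ₗ[R] N'} (hj' : Function.Injective j')
    (h : GoodEmb n j) (h' : GoodEmb n j') : GoodEmb n (j' ∘ₗ j) := by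
  intro X hX
  obtain ⟨D, hXD, hND, hD⟩ := h' X hX
  set A := LinearMap.range j' with hA
  have hfin : Module.Finite R (D.map A.mkQ) := FinNPres.finite hD
  have hfp : Module.FinitePresentation R (D.map A.mkQ) := FinNPres.finitePresentation hn hD
  obtain ⟨Y0, hY0, hY0D, hY0q⟩ := exists_fg_lift A.mkQ D (Module.Finite.iff_fg.1 hfin)
  let Y := Y0 ⊔ X
  have hY : Y.FG := hY0.sup hX
  have hYD : Y ≤ D := sup_le hY0D hXD
  have hYq : Y.map A.mkQ = D.map A.mkQ :=
    le_antisymm (Submodule.map_mono hYD) (hY0q ▸ Submodule.map_mono le_sup_left)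
  have hYfin : Module.Finite R Y := Module.Finite.iff_fg.2 hY
  let l : Y →ₗ[R] D.map A.mkQ := (A.mkQ ∘ₗ Y.subtype).codRestrict _ (fun y =>
    ⟨y, hYD y.2, rfl⟩)
  have hl : Function.Surjective l := by
    rintro ⟨z, hz⟩
    rw [← hYq] at hz
    obtain ⟨y, hy, rfl⟩ := hz
    exact ⟨⟨y, hy⟩, rfl⟩
  have hker : (LinearMap.ker l).FG := Module.FinitePresentation.fg_ker l hl
  have hcap : (Y.comap j').FG := by
    refine Submodule.fg_of_fg_map_injective j' hj' ?_
    have : (Y.comap j').map j' = (LinearMap.ker l).map Y.subtype := by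
      ext x
      constructor
      · rintro ⟨y, hy, rfl⟩
        refine ⟨⟨j' y, hy⟩, ?_, rfl⟩
        apply Subtype.ext
        change A.mkQ (j' y) = 0
        simp [hA]
      · rintro ⟨⟨y, hy⟩, hz, rfl⟩
        have h1 : A.mkQ y = 0 := congrArg Subtype.val hz
        have h2 : y ∈ A := by simpa using h1
        obtain ⟨x, rfl⟩ := h2
        exact ⟨x, hy, rfl⟩
    rw [this]
    exact hker.map _
  obtain ⟨B, hYB, hLB, hB⟩ := h _ hcap
  have hr : LinearMap.range (j' ∘ₗ j) = (LinearMap.range j).map j' := LinearMap.range_comp _ _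
  refine ⟨B.map j' ⊔ Y, le_sup_of_le_right le_sup_right, ?_, ?_⟩
  · rw [hr]
    exact le_sup_of_le_left (Submodule.map_mono hLB)
  · rw [hr]
    refine NPQ.trans (B := B.map j') (Submodule.map_mono hLB) le_sup_left (hB.map hLB j' hj') ?_
    refine NPQ.of_range Y.subtype l (by rw [Submodule.range_subtype]) ?_ ?_
    · rintro ⟨y, hy⟩
      constructor
      · intro hz
        have h1 : A.mkQ y = 0 := congrArg Subtype.val hz
        have h2 : y ∈ A := by simpa using h1
        obtain ⟨x, rfl⟩ := h2
        exact ⟨x, hYB hy, rfl⟩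
      · rintro ⟨x, hx, hxy⟩
        have hxy' : j' x = y := hxy
        apply Subtype.ext
        change A.mkQ y = 0
        simp [hA, ← hxy']
    · rw [LinearMap.range_eq_top.2 hl]
      exact FinNPres.equiv Submodule.topEquiv.symm hD

/-- Attaching a family of modules along submodules. -/
theorem exists_family_pushout {I : Type u} (E : I → Type u) [∀ i, AddCommGroup (E i)]
    [∀ i, Module R (E i)] (S : ∀ i, Submodule R (E i)) (N : Type u) [AddCommGroup N] [Module R N]
    (f : ∀ i, S i →ₗ[R] N) :
    ∃ (N' : Type u) (_ : AddCommGroup N') (_ : Module R N') (j : N →ₗ[R] N')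
      (g : ∀ i, E i →ₗ[R] N'), Function.Injective j ∧ (∀ i (s : S i), g i s = j (f i s)) ∧
      (∀ x : N', ∃ t : Finset I, x ∈ LinearMap.range j ⊔ ⨆ i ∈ t, LinearMap.range (g i)) ∧
      (∀ (t : Finset I) (i : I), i ∉ t → ∀ z : E i,
        g i z ∈ LinearMap.range j ⊔ ⨆ i ∈ t, LinearMap.range (g i) → z ∈ S i) := by
  classical
  let e : (Π₀ i : I, S i) →ₗ[R] (Π₀ i : I, E i) :=
    DFinsupp.mapRange.linearMap (fun i => (S i).subtype)
  have he0 : ∀ x i, e x i = (x i : E i) := fun x i => by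
    simp only [e]
    rw [DFinsupp.mapRange.linearMap_apply, DFinsupp.mapRange_apply]
    rfl
  have he : Function.Injective e := by
    intro x y hxy
    ext i : 1
    apply Subtype.ext
    rw [← he0, ← he0, hxy]
  have hes : ∀ i (s : S i), e (DFinsupp.single i s) = DFinsupp.single i (s : E i) := by
    intro i s
    ext k : 1
    rw [he0]
    by_cases h : k = i
    · subst h; rw [DFinsupp.single_eq_same, DFinsupp.single_eq_same]
    · rw [DFinsupp.single_eq_of_ne h, DFinsupp.single_eq_of_ne h]; rfl
  let T := LinearMap.range e
  let ε := LinearEquiv.ofInjective e he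
  let σ : (Π₀ i : I, S i) →ₗ[R] N := DFinsupp.lsum ℕ f
  have hσ : ∀ i (s : S i), σ (DFinsupp.single i s) = f i s := fun i s => by
    simp only [σ]
    exact DFinsupp.lsum_single (S := ℕ) f i s
  obtain ⟨N', _, _, j, g, q, hj, hq, hjq, hqg, hgt⟩ :=
    exists_pushout T (σ ∘ₗ ε.symm.toLinearMap)
  have hgs : ∀ i (s : S i), g (DFinsupp.single i (s : E i)) = j (f i s) := by
    intro i s
    have h1 := hgt (ε (DFinsupp.single i s))
    rw [LinearMap.comp_apply, LinearEquiv.coe_coe, LinearEquiv.symm_apply_apply, hσ] at h1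
    rw [← h1, ← hes]
    rfl
  have hgj : ∀ y, g y ∈ LinearMap.range j → ∀ i, y i ∈ S i := by
    intro y hy i
    rw [hjq, LinearMap.mem_ker, hqg] at hy
    have h1 : y ∈ T := by simpa using hy
    obtain ⟨x, rfl⟩ := h1
    rw [he0]
    exact (x i).2
  have hall : ∀ x : N', ∃ m y, x = j m + g y := by
    intro x
    obtain ⟨y, hy⟩ := T.mkQ_surjective (q x)
    have : x - g y ∈ LinearMap.range j := by
      rw [hjq, LinearMap.mem_ker, map_sub, hqg, hy, sub_self]
    obtain ⟨m, hm⟩ := this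
    exact ⟨m, y, by rw [hm]; abel⟩
  let lin : ∀ i : I, E i →ₗ[R] (Π₀ i : I, E i) := fun i => DFinsupp.lsingle (R := R) (M := E) i
  have hlin : ∀ i (x : E i), lin i x = DFinsupp.single i x := fun _ _ => rfl
  refine ⟨N', inferInstance, inferInstance, j, fun i => g ∘ₗ lin i, hj, hgs, ?_, ?_⟩
  · intro x
    obtain ⟨m, y, rfl⟩ := hall x
    refine ⟨y.support, Submodule.add_mem_sup ⟨m, rfl⟩ ?_⟩
    have h1 : y = ∑ i ∈ y.support, lin i (y i) := (DFinsupp.sum_single (f := y)).symm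
    have h2 : g y = ∑ i ∈ y.support, g (lin i (y i)) := by
      conv_lhs => rw [h1]
      rw [map_sum]
    rw [h2]
    exact Submodule.sum_mem _ (fun i hi =>
      Submodule.mem_iSup_of_mem i (Submodule.mem_iSup_of_mem hi ⟨y i, rfl⟩))
  · intro t i hi z hz
    have hsup : (⨆ i ∈ t, LinearMap.range (g ∘ₗ lin i)) ≤
        (LinearMap.ker (DFinsupp.lapply i : (Π₀ i : I, E i) →ₗ[R] E i)).map g := by
      refine iSup₂_le ?_
      rintro a ha _ ⟨w, rfl⟩
      refine ⟨lin a w, ?_, rfl⟩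
      have : a ≠ i := fun h => hi (h ▸ ha)
      exact DFinsupp.single_eq_of_ne this.symm
    obtain ⟨a, ha, b, hb, hab⟩ := Submodule.mem_sup.1 hz
    obtain ⟨y, hy, rfl⟩ := hsup hb
    have hy' : y i = 0 := hy
    have h1 : g (lin i z - y) ∈ LinearMap.range j := by
      have h2 : g (lin i z - y) = a := by
        rw [map_sub, sub_eq_iff_eq_add]
        exact hab.symm
      rw [h2]; exact ha
    have h3 := hgj _ h1 i
    rw [DFinsupp.sub_apply, hy', sub_zero, hlin, DFinsupp.single_eq_same] at h3
    exact h3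

/-- One step of the construction. -/
theorem exists_step (n : ℕ) (N : Type u) [AddCommGroup N] [Module R N] :
    ∃ (N' : ModuleCat.{u} R) (j : N →ₗ[R] N'), Function.Injective j ∧ GoodEmb n j ∧
      ∀ (k : ℕ) (S : Submodule R (Fin k → R)), FinNPres R n ((Fin k → R) ⧸ S) →
        ∀ f : S →ₗ[R] N, ∃ g : (Fin k → R) →ₗ[R] N', ∀ s : S, g s = j (f s) := by
  classical
  let I : Type u := Σ k : ℕ, Σ S : {S : Submodule R (Fin k → R) // FinNPres R n ((Fin k → R) ⧸ S)},
    (S.1 →ₗ[R] N)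
  obtain ⟨N', _, _, j, g, hj, hgs, hall, hind⟩ := exists_family_pushout
    (fun i : I => (Fin i.1 → R)) (fun i => i.2.1.1) N (fun i => i.2.2)
  refine ⟨ModuleCat.of R N', j, hj, ?_, ?_⟩
  · have hNP : ∀ t : Finset I, NPQ n (LinearMap.range j)
        (LinearMap.range j ⊔ ⨆ i ∈ t, LinearMap.range (g i)) := by
      intro t
      induction t using Finset.induction_on with
      | empty =>
        refine NPQ.of_range (0 : PUnit.{u+1} →ₗ[R] N') (0 : PUnit.{u+1} →ₗ[R] PUnit.{u+1}) ?_ ?_ ?_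
        · simp
        · intro z; simp
        · exact FinNPres.of_subsingleton _ _
      | insert i t hi ih =>
        refine NPQ.trans le_sup_left ?_ ih ?_
        · exact sup_le_sup_left (biSup_mono (fun _ => Finset.mem_insert_of_mem)) _
        · refine NPQ.of_range (g i) (i.2.1.1.mkQ) ?_ ?_ ?_
          · rw [Finset.iSup_insert, sup_assoc, sup_comm (LinearMap.range (g i))]
          · intro z
            constructor
            · intro hz
              have hz' : z ∈ i.2.1.1 := by simpa using hz
              exact Submodule.mem_sup_left ⟨_, (hgs i ⟨z, hz'⟩).symm⟩
            · intro hz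
              simpa using hind t i hi z hz
          · rw [Submodule.range_mkQ]
            exact FinNPres.equiv Submodule.topEquiv.symm i.2.1.2
    intro X hX
    have hX' : ∃ t : Finset I, X ≤ LinearMap.range j ⊔ ⨆ i ∈ t, LinearMap.range (g i) := by
      induction X, hX using Submodule.fg_induction with
      | singleton x =>
        obtain ⟨t, ht⟩ := hall x
        exact ⟨t, (Submodule.span_singleton_le_iff_mem _ _).2 ht⟩
      | sup M₁ M₂ _ _ h1 h2 =>
        obtain ⟨t1, h1⟩ := h1
        obtain ⟨t2, h2⟩ := h2
        refine ⟨t1 ∪ t2, sup_le (h1.trans ?_) (h2.trans ?_)⟩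
        · exact sup_le_sup_left (biSup_mono (fun _ => Finset.mem_union_left _)) _
        · exact sup_le_sup_left (biSup_mono (fun _ => Finset.mem_union_right _)) _
    obtain ⟨t, ht⟩ := hX'
    exact ⟨_, ht, le_sup_left, hNP t⟩
  · intro k S hS f
    exact ⟨g ⟨k, ⟨S, hS⟩, f⟩, fun s => hgs ⟨k, ⟨S, hS⟩, f⟩ s⟩

end GoodEmbeddings

section MainConstruction

variable {R : Type u} [Ring R]

/-- The tower of modules obtained by iterating `exists_step`. -/
noncomputable def towerObj (n : ℕ) (L : Type u) [AddCommGroup L] [Module R L] :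
    ℕ → ModuleCat.{u} R
  | 0 => ModuleCat.of R L
  | i + 1 => Classical.choose (exists_step (R := R) n (towerObj n L i))

/-- The transition maps of the tower. -/
noncomputable def towerMap (n : ℕ) (L : Type u) [AddCommGroup L] [Module R L] (i : ℕ) :
    towerObj (R := R) n L i →ₗ[R] towerObj (R := R) n L (i + 1) :=
  Classical.choose (Classical.choose_spec (exists_step (R := R) n (towerObj (R := R) n L i)))

theorem towerMap_spec (n : ℕ) (L : Type u) [AddCommGroup L] [Module R L] (i : ℕ) :
    Function.Injective (towerMap (R := R) n L i) ∧ GoodEmb n (towerMap (R := R) n L i) ∧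
      ∀ (k : ℕ) (S : Submodule R (Fin k → R)), FinNPres R n ((Fin k → R) ⧸ S) →
        ∀ f : S →ₗ[R] towerObj (R := R) n L i,
          ∃ g : (Fin k → R) →ₗ[R] towerObj (R := R) n L (i + 1),
            ∀ s : S, g s = towerMap (R := R) n L i (f s) :=
  Classical.choose_spec
    (Classical.choose_spec (exists_step (R := R) n (towerObj (R := R) n L i)))

theorem exists_good_embedding {n : ℕ} (hn : 1 ≤ n) (L : Type u) [AddCommGroup L] [Module R L] :
    ∃ (N : Type u) (_ : AddCommGroup N) (_ : Module R N) (j : L →ₗ[R] N),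
      Function.Injective j ∧ GoodEmb n j ∧
      ∀ (k : ℕ) (S : Submodule R (Fin k → R)), S.FG → FinNPres R n ((Fin k → R) ⧸ S) →
        ∀ f : S →ₗ[R] N, ∃ g : (Fin k → R) →ₗ[R] N, ∀ s : S, g s = f s := by
  obtain ⟨N, _, _, c, hcinj, hc, hcall⟩ := exists_seq_colimit (towerObj (R := R) n L)
    (towerMap (R := R) n L) (fun i => (towerMap_spec n L i).1)
  have hmono : Monotone (fun i => LinearMap.range (c i)) := by
    refine monotone_nat_of_le_succ ?_
    rintro i _ ⟨x, rfl⟩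
    exact ⟨_, hc i x⟩
  have hfg : ∀ X : Submodule R N, X.FG → ∃ i, X ≤ LinearMap.range (c i) := by
    intro X hX
    induction X, hX using Submodule.fg_induction with
    | singleton x =>
      obtain ⟨i, y, rfl⟩ := hcall x
      exact ⟨i, by rw [Submodule.span_singleton_le_iff_mem]; exact ⟨y, rfl⟩⟩
    | sup X Y _ _ h1 h2 =>
      obtain ⟨i, hi⟩ := h1
      obtain ⟨k, hk⟩ := h2
      exact ⟨max i k, sup_le (hi.trans (hmono (le_max_left _ _)))
        (hk.trans (hmono (le_max_right _ _)))⟩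
  have hcomp : ∀ i, ∃ v : L →ₗ[R] towerObj (R := R) n L i, GoodEmb n v ∧
      ∀ x : L, c i (v x) = c 0 x := by
    intro i
    induction i with
    | zero => exact ⟨LinearMap.id, GoodEmb.id n L, fun x => rfl⟩
    | succ i ih =>
      obtain ⟨v, hv, hvc⟩ := ih
      refine ⟨towerMap (R := R) n L i ∘ₗ v,
        GoodEmb.comp hn (towerMap_spec n L i).1 hv (towerMap_spec n L i).2.1, fun x => ?_⟩
      rw [LinearMap.comp_apply, hc, hvc]
  let j : L →ₗ[R] N := c 0
  refine ⟨N, inferInstance, inferInstance, j, hcinj 0, ?_, ?_⟩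
  · intro X hX
    obtain ⟨i, hi⟩ := hfg X hX
    obtain ⟨v, hv, hvc⟩ := hcomp i
    have hXm : (X.comap (c i)).map (c i) = X := by
      rw [Submodule.map_comap_eq, inf_eq_right.2 hi]
    have hXfg : (X.comap (c i)).FG :=
      Submodule.fg_of_fg_map_injective (c i) (hcinj i) (by rw [hXm]; exact hX)
    obtain ⟨B, hXB, hvB, hB⟩ := hv _ hXfg
    have hr : LinearMap.range j = (LinearMap.range v).map (c i) := by
      rw [← LinearMap.range_comp]
      congr 1
      ext x
      exact (hvc x).symm
    refine ⟨B.map (c i), ?_, ?_, ?_⟩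
    · rw [← hXm]
      exact Submodule.map_mono hXB
    · rw [hr]
      exact Submodule.map_mono hvB
    · rw [hr]
      exact NPQ.map hvB (c i) (hcinj i) hB
  · intro k S hS hQ f
    have : Module.Finite R S := Module.Finite.iff_fg.2 hS
    have hrf : (LinearMap.range f).FG := Module.Finite.iff_fg.1 inferInstance
    obtain ⟨i, hi⟩ := hfg _ hrf
    obtain ⟨f', hf'⟩ := exists_corestrict (c i) (hcinj i) f (fun y => hi ⟨y, rfl⟩)
    obtain ⟨g, hg⟩ := (towerMap_spec n L i).2.2 k S hQ f'
    refine ⟨c (i + 1) ∘ₗ g, fun s => ?_⟩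
    rw [LinearMap.comp_apply, hg, hc, hf']

theorem fpdInj_of_extend {n : ℕ} (hn : 1 ≤ n) (d : ℕ∞) (N : Type u) [AddCommGroup N] [Module R N]
    (h : ∀ (k : ℕ) (S : Submodule R (Fin k → R)), S.FG → FinNPres R n ((Fin k → R) ⧸ S) →
        ∀ f : S →ₗ[R] N, ∃ g : (Fin k → R) →ₗ[R] N, ∀ s : S, g s = f s) : FPdInj R n d N := by
  intro K _ _ hK _
  obtain ⟨m, rfl⟩ : ∃ m, n = m + 1 := ⟨n - 1, by omega⟩
  have hK' := hK
  obtain ⟨k, f, hf, hk⟩ := hK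
  refine Ext1Zero.of_extend f hf ?_
  exact h k (LinearMap.ker f) (Module.Finite.iff_fg.1 hk.finite)
    (hK'.equiv (f.quotKerEquivOfSurjective hf).symm)

/-- A finitely generated `FPₙ^{≤d}`-projective module is finitely `n`-presented. -/
theorem finNPres_of_fpdProj {n : ℕ} (hn : 1 ≤ n) (d : ℕ∞) (K : Type u) [AddCommGroup K]
    [Module R K] [Module.Finite R K] (h : FPdProj R n d K) : FinNPres R n K := by
  obtain ⟨k, π, hπ⟩ := Module.Finite.exists_fin' R K
  obtain ⟨N, _, _, j, hj, hgood, hext⟩ := exists_good_embedding (R := R) hn (LinearMap.ker π)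
  obtain ⟨φ, hφ⟩ := (h N (fpdInj_of_extend hn d N hext)).extend π hπ j
  obtain ⟨B, hXB, hjB, hB⟩ := hgood (LinearMap.range φ) (Module.Finite.iff_fg.1 inferInstance)
  set A := LinearMap.range j with hA
  have hφA : ∀ y, π y = 0 → A.mkQ (φ y) = 0 := by
    intro y hy
    rw [Submodule.mkQ_apply, Submodule.Quotient.mk_eq_zero]
    exact ⟨⟨y, hy⟩, (hφ ⟨y, hy⟩).symm⟩
  obtain ⟨ψ, hψ⟩ := exists_descend π hπ (A.mkQ ∘ₗ φ) hφA
  have hψB : ∀ x, ψ x ∈ B.map A.mkQ := by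
    intro x
    obtain ⟨y, rfl⟩ := hπ x
    rw [hψ]
    exact ⟨φ y, hXB ⟨y, rfl⟩, rfl⟩
  let i : (Fin k → R) →ₗ[R] B × K := (φ.codRestrict B (fun y => hXB ⟨y, rfl⟩)).prod π
  let p0 : B × K →ₗ[R] N ⧸ A :=
    (A.mkQ ∘ₗ B.subtype) ∘ₗ LinearMap.fst R B K - ψ ∘ₗ LinearMap.snd R B K
  have hp0 : ∀ b x, p0 (b, x) = A.mkQ (b : N) - ψ x := fun b x => rfl
  let p : B × K →ₗ[R] B.map A.mkQ := p0.codRestrict _ (by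
    rintro ⟨b, x⟩
    rw [hp0]
    exact Submodule.sub_mem _ ⟨b, b.2, rfl⟩ (hψB x))
  have hBK : FinNPres R n (B × K) := by
    refine FinNPres.ext i p ?_ ?_ ?_ (FinNPres.free n k) hB
    · rw [← LinearMap.ker_eq_bot, LinearMap.ker_eq_bot']
      intro y hy
      have h1 : φ y = 0 := congrArg (fun z : B × K => (z.1 : N)) hy
      have h2 : π y = 0 := congrArg (fun z : B × K => z.2) hy
      have h3 : j ⟨y, h2⟩ = 0 := by rw [← hφ]; exact h1
      have h4 : (⟨y, h2⟩ : LinearMap.ker π) = 0 := hj (by rw [h3, map_zero])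
      exact congrArg Subtype.val h4
    · rintro ⟨_, b, hb, rfl⟩
      refine ⟨(⟨b, hb⟩, 0), Subtype.ext ?_⟩
      change p0 (⟨b, hb⟩, 0) = _
      rw [hp0, map_zero, sub_zero]
    · apply le_antisymm
      · rintro _ ⟨y, rfl⟩
        refine Subtype.ext ?_
        change A.mkQ (φ y) - ψ (π y) = 0
        rw [hψ]
        exact sub_self _
      · rintro ⟨b, x⟩ hbx
        have h1 : A.mkQ (b : N) - ψ x = 0 := congrArg Subtype.val (LinearMap.mem_ker.1 hbx)
        obtain ⟨y, rfl⟩ := hπ x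
        rw [hψ, LinearMap.comp_apply, ← map_sub, Submodule.mkQ_apply,
          Submodule.Quotient.mk_eq_zero] at h1
        obtain ⟨l, hl⟩ := h1
        refine ⟨y + l, ?_⟩
        refine Prod.ext (Subtype.ext ?_) ?_
        · change φ (y + l) = b
          rw [map_add, hφ, hl]
          abel
        · change π (y + l) = π y
          rw [map_add, LinearMap.mem_ker.1 l.2, add_zero]
  exact (hBK.equiv (LinearEquiv.prodComm R B K)).fst

end MainConstruction

/-- `R` is left `(n,d)`-coherent if and only if `Ext²_R(M, N) = 0` for every finitely
`n`-presented `M` of projective dimension at most `d` and every `FPₙ^{≤d}`-injective `N`. -/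
theorem ndCohRing_iff_ext2_vanishes (R : Type u) [Ring R] (n : ℕ) (hn : 1 ≤ n)
    (d : ℕ∞) (hd : 1 ≤ d) :
    NDCohRing R n d ↔
      ∀ (M : Type u) [AddCommGroup M] [Module R M], FinNPres R n M → ProjDimLE' R d M →
        ∀ (N : Type u) [AddCommGroup N] [Module R N], FPdInj R n d N →
          ExtSuccZero R 1 M N := by
  constructor
  · intro hR M _ _ hM hpd N _ _ hN P _ _ hP p hp
    obtain ⟨k, f, hf, hk⟩ := hR M hM hpd
    have h1 : ProjDimLE' R d (LinearMap.ker f) := ProjDimLE'.ker hd f hf hpd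
    exact Ext1Zero.schanuel f hf p hp (hN _ hk h1)
  · intro h M _ _ hM hpd
    obtain ⟨m, rfl⟩ : ∃ m, n = m + 1 := ⟨n - 1, by omega⟩
    have hM' := hM
    obtain ⟨k, f, hf, hk⟩ := hM
    have : Module.Finite R (LinearMap.ker f) := hk.finite
    refine ⟨k, f, hf, finNPres_of_fpdProj hn d _ ?_⟩
    intro N _ _ hN
    exact h M hM' hpd N hN _ inferInstance f hf
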